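/- There exist universal constants c, γ, c_partial > 0 such that the following holds. Let n ≥ 2, Δ > 0, q = (n+1)(n+2)/2, h ∈ {1, …, n(n+1)/2}, and let ψ be the orthonormal quadratic basis on [−Δ,Δ]^n with μ the uniform probability measure on [−Δ,Δ]^n. Let Y = (y¹, …, y^p) be drawn according to μ^{⊗p}, with M(ψ,Y) ∈ ℝ^{p×q} the matrix [M(ψ,Y)]_{ij} = ψ_j(y^i), split as (M(ψ_Q,Y), M(ψ_L,Y)) into the columns indexed by the degree-2 elements ψ_Q and the degree-≤1 elements ψ_L. If p / log p ≥ 9c·(h+n+1)·(log(h+n+1))²·log q, then with μ^{⊗p}-probability at least 1 − n^{−γ log p} the following holds simultaneously for every coefficient vector z̄ = (z̄_Q, z̄_L) ∈ ℝ^q whose quadratic part z̄_Q is h-sparse: for every η ≥ 0, every noise vector ε' ∈ ℝ^p with ‖ε'‖₂ ≤ η, and every minimizer z* of ‖z_Q‖₁ over {z = (z_Q, z_L) : ‖M(ψ,Y)z − b‖₂ ≤ η}, where b = M(ψ,Y)z̄ + ε', one has ‖z* − z̄‖₂ ≤ (c_partial/√p)·η. -/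

import Mathlib

open Matrix BigOperators MeasureTheory

/-- The Euclidean (`ℓ₂`) norm of a finitely-indexed real vector. -/
noncomputable def l2 {ι : Type*} [Fintype ι] (v : ι → ℝ) : ℝ := Real.sqrt (∑ i, v i ^ 2)

/-- The `ℓ₁` norm of a finitely-indexed real vector. -/
noncomputable def l1 {ι : Type*} [Fintype ι] (v : ι → ℝ) : ℝ := ∑ i, |v i|

/-- `card' v` is the number of nonzero entries of `v`. -/
noncomputable def card' {ι : Type*} (v : ι → ℝ) : ℕ := Nat.card {i : ι // v i ≠ 0}

/-- `v` is `s`-sparse if it has at most `s` nonzero entries. -/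
def Sparse {ι : Type*} (s : ℕ) (v : ι → ℝ) : Prop := card' v ≤ s

/-- `A` satisfies the Restricted Isometry Property of order `s` with constant `δ`:
`(1 - δ)‖z‖₂² ≤ ‖Az‖₂² ≤ (1 + δ)‖z‖₂²` for every `s`-sparse vector `z`. -/
def RIP {k : ℕ} {ι : Type*} [Fintype ι] (s : ℕ) (δ : ℝ) (A : Matrix (Fin k) ι ℝ) : Prop :=
  ∀ z : ι → ℝ, Sparse s z →
    (1 - δ) * l2 z ^ 2 ≤ l2 (A.mulVec z) ^ 2 ∧ l2 (A.mulVec z) ^ 2 ≤ (1 + δ) * l2 z ^ 2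

/-- Index set for the degree-2 "off-diagonal" basis elements: pairs `i < j`. -/
abbrev Pairs (n : ℕ) := {p : Fin n × Fin n // p.1 < p.2}

/-- Index set for the quadratic part `ψ_Q` of the basis: diagonal terms and pairs `i < j`. -/
abbrev QIdx (n : ℕ) := Fin n ⊕ Pairs n

/-- Index set for the affine part `ψ_L` of the basis: linear terms and the constant term. -/
abbrev LIdx (n : ℕ) := Fin n ⊕ Unit

/-- Index set for the whole basis `ψ`, of cardinality `(n+1)(n+2)/2`. -/
abbrev Idx (n : ℕ) := QIdx n ⊕ LIdx n

/-- The orthonormal quadratic basis `ψ` on the hypercube `[−Δ,Δ]^n`: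
`ψ_{2,i}(x) = (3√5/(2Δ²))x_i² − √5/2`, `ψ_{2,ij}(x) = (3/Δ²)x_i x_j` (`i < j`),
`ψ_{1,i}(x) = (√3/Δ)x_i`, and `ψ_0(x) = 1`. -/
noncomputable def psi (n : ℕ) (Δ : ℝ) : Idx n → (Fin n → ℝ) → ℝ
  | Sum.inl (Sum.inl i) => fun x => 3 * Real.sqrt 5 / (2 * Δ ^ 2) * x i ^ 2 - Real.sqrt 5 / 2
  | Sum.inl (Sum.inr p) => fun x => 3 / Δ ^ 2 * (x p.1.1 * x p.1.2)
  | Sum.inr (Sum.inl i) => fun x => Real.sqrt 3 / Δ * x i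
  | Sum.inr (Sum.inr _) => fun _ => 1

/-- The hypercube `B_∞(0;Δ) = [−Δ,Δ]^n`. -/
def cube (n : ℕ) (Δ : ℝ) : Set (Fin n → ℝ) := {x | ∀ i, |x i| ≤ Δ}

/-- The uniform probability measure `μ` on the hypercube `[−Δ,Δ]^n`. -/
noncomputable def mu (n : ℕ) (Δ : ℝ) : MeasureTheory.Measure (Fin n → ℝ) :=
  (ENNReal.ofReal ((2 * Δ) ^ n))⁻¹ •
    MeasureTheory.Measure.pi (fun _ : Fin n => MeasureTheory.volume.restrict (Set.Icc (-Δ) Δ))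

/-! ### Fourth moments of quadratic polynomials in independent variables -/

/-- One-dimensional orthonormal system with bounded entries. -/
structure OK1 (ν : Measure ℝ) (f1 f2 : ℝ → ℝ) : Prop where
  meas1 : Measurable f1
  meas2 : Measurable f2
  bd1 : ∀ t, f1 t ^ 2 ≤ 5
  bd2 : ∀ t, f2 t ^ 2 ≤ 5
  i1 : ∫ t, f1 t ∂ν = 0
  i2 : ∫ t, f2 t ∂ν = 0
  i12 : ∫ t, f1 t * f2 t ∂ν = 0
  i11 : ∫ t, f1 t ^ 2 ∂ν = 1
  i22 : ∫ t, f2 t ^ 2 ∂ν = 1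

set_option linter.unusedSectionVars false
set_option linter.unusedSimpArgs false

section moments
variable {ν : Measure ℝ} [IsProbabilityMeasure ν] {f1 f2 : ℝ → ℝ}

lemma bdd_integrable {α : Type*} [MeasurableSpace α] {ρ : Measure α} [IsProbabilityMeasure ρ]
    {g : α → ℝ} (hm : Measurable g) (hb : ∃ C, ∀ x, |g x| ≤ C) : Integrable g ρ := by
  obtain ⟨C, hC⟩ := hb
  exact Integrable.of_bound hm.aestronglyMeasurable C (Filter.Eventually.of_forall hC)

lemma OK1.abs1 (h : OK1 ν f1 f2) (t : ℝ) : |f1 t| ≤ 3 :=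
  abs_le_of_sq_le_sq (by nlinarith [h.bd1 t]) (by norm_num)

lemma OK1.abs2 (h : OK1 ν f1 f2) (t : ℝ) : |f2 t| ≤ 3 :=
  abs_le_of_sq_le_sq (by nlinarith [h.bd2 t]) (by norm_num)

lemma OK1.second (h : OK1 ν f1 f2) (a b k : ℝ) :
    ∫ t, (a + f1 t * b + f2 t * k) ^ 2 ∂ν = a ^ 2 + b ^ 2 + k ^ 2 := by
  have I1 : Integrable f1 ν := bdd_integrable h.meas1 ⟨3, h.abs1⟩
  have I2 : Integrable f2 ν := bdd_integrable h.meas2 ⟨3, h.abs2⟩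
  have I11 : Integrable (fun t => f1 t ^ 2) ν := bdd_integrable (h.meas1.pow_const 2)
    ⟨5, fun t => by rw [abs_of_nonneg (sq_nonneg _)]; exact h.bd1 t⟩
  have I22 : Integrable (fun t => f2 t ^ 2) ν := bdd_integrable (h.meas2.pow_const 2)
    ⟨5, fun t => by rw [abs_of_nonneg (sq_nonneg _)]; exact h.bd2 t⟩
  have I12 : Integrable (fun t => f1 t * f2 t) ν := bdd_integrable (h.meas1.mul h.meas2)
    ⟨9, fun t => by
      rw [abs_mul]
      nlinarith [h.abs1 t, h.abs2 t, abs_nonneg (f1 t), abs_nonneg (f2 t)]⟩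
  have e : ∀ t, (a + f1 t * b + f2 t * k) ^ 2 =
      a ^ 2 + ((2 * a * b) * f1 t + ((2 * a * k) * f2 t + (b ^ 2 * f1 t ^ 2 +
        (k ^ 2 * f2 t ^ 2 + (2 * b * k) * (f1 t * f2 t))))) := fun t => by ring
  simp_rw [e]
  rw [integral_add (by fun_prop) (by fun_prop), integral_add (by fun_prop) (by fun_prop),
    integral_add (by fun_prop) (by fun_prop), integral_add (by fun_prop) (by fun_prop),
    integral_add (by fun_prop) (by fun_prop)]
  simp only [integral_const_mul, h.i1, h.i2, h.i11, h.i22, h.i12]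
  simp
  ring

lemma fourth_pt (a b k x y : ℝ) (hx : x ^ 2 ≤ 5) (hy : y ^ 2 ≤ 5) :
    (a + x * b + y * k) ^ 4 ≤ (a ^ 4 + 600 * (b ^ 4 + k ^ 4)) + ((4 * a ^ 3 * b) * x +
      ((4 * a ^ 3 * k) * y + (8 * a ^ 2) * (0 + x * b + y * k) ^ 2)) := by
  have h1 : (x * b + y * k) ^ 4 ≤ 8 * ((x * b) ^ 4 + (y * k) ^ 4) := by
    have := sq_nonneg (x * b - y * k)
    have h2 : (x * b + y * k) ^ 2 ≤ 2 * ((x * b) ^ 2 + (y * k) ^ 2) := by nlinarith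
    have h3 : ((x * b + y * k) ^ 2) ^ 2 ≤ (2 * ((x * b) ^ 2 + (y * k) ^ 2)) ^ 2 :=
      pow_le_pow_left₀ (sq_nonneg _) h2 2
    nlinarith [sq_nonneg ((x * b) ^ 2 - (y * k) ^ 2)]
  have hx4 : x ^ 4 ≤ 25 := by nlinarith [sq_nonneg x]
  have hy4 : y ^ 4 ≤ 25 := by nlinarith [sq_nonneg y]
  have h4 : (x * b) ^ 4 ≤ 25 * b ^ 4 := by
    rw [mul_pow]; exact mul_le_mul_of_nonneg_right hx4 (by positivity)
  have h5 : (y * k) ^ 4 ≤ 25 * k ^ 4 := by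
    rw [mul_pow]; exact mul_le_mul_of_nonneg_right hy4 (by positivity)
  set u := x * b + y * k with hu
  have e : a + x * b + y * k = a + u := by rw [hu]; ring
  have e2 : (4 * a ^ 3 * b) * x + ((4 * a ^ 3 * k) * y + (8 * a ^ 2) * (0 + x * b + y * k) ^ 2)
     = 4 * a ^ 3 * u + 8 * a ^ 2 * u ^ 2 := by rw [hu]; ring
  rw [e, e2]
  nlinarith [sq_nonneg (a * u - u ^ 2)]

lemma OK1.fourth (h : OK1 ν f1 f2) (a b k : ℝ) :
    ∫ t, (a + f1 t * b + f2 t * k) ^ 4 ∂ν ≤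
      a ^ 4 + 8 * (a ^ 2 * b ^ 2) + 8 * (a ^ 2 * k ^ 2) + 600 * (b ^ 4 + k ^ 4) := by
  have I1 : Integrable f1 ν := bdd_integrable h.meas1 ⟨3, h.abs1⟩
  have I2 : Integrable f2 ν := bdd_integrable h.meas2 ⟨3, h.abs2⟩
  have m1 := h.meas1
  have m2 := h.meas2
  have key : ∀ c t, |c + f1 t * b + f2 t * k| ≤ |c| + 3 * |b| + 3 * |k| := fun c t => by
    refine (abs_add_three _ _ _).trans ?_
    rw [abs_mul, abs_mul]
    gcongr
    · exact h.abs1 t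
    · exact h.abs2 t
  have Isq : Integrable (fun t => (0 + f1 t * b + f2 t * k) ^ 2) ν :=
    bdd_integrable (by fun_prop) ⟨(|0| + 3 * |b| + 3 * |k|) ^ 2, fun t => by
      rw [abs_pow]; exact pow_le_pow_left₀ (abs_nonneg _) (key 0 t) 2⟩
  have I4 : Integrable (fun t => (a + f1 t * b + f2 t * k) ^ 4) ν :=
    bdd_integrable (by fun_prop) ⟨(|a| + 3 * |b| + 3 * |k|) ^ 4, fun t => by
      rw [abs_pow]; exact pow_le_pow_left₀ (abs_nonneg _) (key a t) 4⟩
  calc _ ≤ ∫ t, ((a ^ 4 + 600 * (b ^ 4 + k ^ 4)) + ((4 * a ^ 3 * b) * f1 t +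
      ((4 * a ^ 3 * k) * f2 t + (8 * a ^ 2) * (0 + f1 t * b + f2 t * k) ^ 2))) ∂ν :=
        integral_mono I4 (by fun_prop) (fun t => fourth_pt a b k _ _ (h.bd1 t) (h.bd2 t))
    _ = _ := by
      rw [integral_add (by fun_prop) (by fun_prop), integral_add (by fun_prop) (by fun_prop),
        integral_add (by fun_prop) (by fun_prop), integral_add (by fun_prop) (by fun_prop)]
      simp only [integral_const_mul, h.i1, h.i2, h.second]
      simp
      ring

lemma integral_cons {n : ℕ} {F : (Fin (n + 1) → ℝ) → ℝ} (hm : Measurable F)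
    (hb : ∃ C, ∀ x, |F x| ≤ C) :
    ∫ x, F x ∂(Measure.pi fun _ => ν) =
      ∫ x, ∫ t, F (Fin.cons t x) ∂ν ∂(Measure.pi fun _ : Fin n => ν) := by
  have mp := (measurePreserving_piFinSuccAbove (fun _ : Fin (n + 1) => ν) 0).symm
  rw [← mp.integral_comp (MeasurableEquiv.measurableEmbedding _)]
  have e : ∀ z : ℝ × (Fin n → ℝ),
      (MeasurableEquiv.piFinSuccAbove (fun _ : Fin (n + 1) => ℝ) 0).symm z = Fin.cons z.1 z.2 := by
    intro z
    simp [MeasurableEquiv.piFinSuccAbove, Fin.insertNthEquiv]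
  have hi : Integrable (fun z : ℝ × (Fin n → ℝ) => F (Fin.cons z.1 z.2))
      (ν.prod (Measure.pi fun _ : Fin n => ν)) := by
    refine bdd_integrable ?_ ?_
    · have := hm.comp (MeasurableEquiv.piFinSuccAbove (fun _ : Fin (n + 1) => ℝ) 0).symm.measurable
      convert this using 2 with z
      rw [Function.comp, e]
    · obtain ⟨C, hC⟩ := hb
      exact ⟨C, fun z => hC _⟩
  simp_rw [e]
  exact integral_prod_symm _ hi

/-- affine function -/
noncomputable def af (f1 : ℝ → ℝ) {n : ℕ} (a : ℝ) (b : Fin n → ℝ) (x : Fin n → ℝ) : ℝ :=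
  a + ∑ i, b i * f1 (x i)

/-- quadratic function -/
noncomputable def qf (f1 f2 : ℝ → ℝ) {n : ℕ} (a : ℝ) (b d : Fin n → ℝ) (c : Fin n → Fin n → ℝ)
    (x : Fin n → ℝ) : ℝ :=
  a + ∑ i, b i * f1 (x i) + ∑ i, d i * f2 (x i) +
    ∑ i, ∑ j, if i < j then c i j * (f1 (x i) * f1 (x j)) else 0

lemma af_meas (h : OK1 ν f1 f2) {n : ℕ} (a : ℝ) (b : Fin n → ℝ) : Measurable (af f1 a b) := by
  have := h.meas1
  unfold af
  fun_prop

lemma qf_meas (h : OK1 ν f1 f2) {n : ℕ} (a : ℝ) (b d : Fin n → ℝ) (c : Fin n → Fin n → ℝ) :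
    Measurable (qf f1 f2 a b d c) := by
  have := h.meas1
  have := h.meas2
  unfold qf
  refine Measurable.add (by fun_prop) ?_
  refine Finset.measurable_fun_sum _ fun i _ => Finset.measurable_fun_sum _ fun j _ => ?_
  split_ifs <;> fun_prop

lemma af_bdd (h : OK1 ν f1 f2) {n : ℕ} (a : ℝ) (b : Fin n → ℝ) :
    ∃ C, ∀ x, |af f1 a b x| ≤ C := by
  refine ⟨|a| + ∑ i, |b i| * 3, fun x => ?_⟩
  unfold af
  refine (abs_add_le _ _).trans ?_
  gcongr
  refine (Finset.abs_sum_le_sum_abs _ _).trans ?_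
  gcongr with i
  rw [abs_mul]
  gcongr
  exact h.abs1 _

lemma qf_bdd (h : OK1 ν f1 f2) {n : ℕ} (a : ℝ) (b d : Fin n → ℝ) (c : Fin n → Fin n → ℝ) :
    ∃ C, ∀ x, |qf f1 f2 a b d c x| ≤ C := by
  obtain ⟨C, hC⟩ := af_bdd h a b
  refine ⟨C + ∑ i, |d i| * 3 + ∑ i, ∑ j, |c i j| * 9, fun x => ?_⟩
  have := hC x
  unfold af at this
  unfold qf
  refine (abs_add_three _ _ _).trans ?_
  gcongr
  · refine (Finset.abs_sum_le_sum_abs _ _).trans ?_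
    gcongr with i
    rw [abs_mul]
    gcongr
    exact h.abs2 _
  · refine (Finset.abs_sum_le_sum_abs _ _).trans ?_
    gcongr with i
    refine (Finset.abs_sum_le_sum_abs _ _).trans ?_
    gcongr with j
    split_ifs
    · rw [abs_mul, abs_mul]
      gcongr
      nlinarith [h.abs1 (x i), h.abs1 (x j), abs_nonneg (f1 (x i)), abs_nonneg (f1 (x j))]
    · simp

lemma pow_bdd {α : Type*} {g : α → ℝ} (hb : ∃ C, ∀ x, |g x| ≤ C) (k : ℕ) :
    ∃ C, ∀ x, |g x ^ k| ≤ C := by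
  obtain ⟨C, hC⟩ := hb
  exact ⟨C ^ k, fun x => by rw [abs_pow]; exact pow_le_pow_left₀ (abs_nonneg _) (hC x) k⟩

lemma mul_bdd {α : Type*} {g f : α → ℝ} (hb : ∃ C, ∀ x, |g x| ≤ C) (hf : ∃ C, ∀ x, |f x| ≤ C) :
    ∃ C, ∀ x, |g x * f x| ≤ C := by
  obtain ⟨C, hC⟩ := hb
  obtain ⟨D, hD⟩ := hf
  exact ⟨C * D, fun x => by
    rw [abs_mul]
    exact mul_le_mul (hC x) (hD x) (abs_nonneg _) ((abs_nonneg _).trans (hC x))⟩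

lemma af_moments (h : OK1 ν f1 f2) {n : ℕ} (a : ℝ) (b : Fin n → ℝ) :
    ∫ x, af f1 a b x ^ 2 ∂(Measure.pi fun _ => ν) = a ^ 2 + ∑ i, b i ^ 2 ∧
    ∫ x, af f1 a b x ^ 4 ∂(Measure.pi fun _ => ν) ≤ 600 * (a ^ 2 + ∑ i, b i ^ 2) ^ 2 := by
  induction n generalizing a with
  | zero => simp [af]; nlinarith [sq_nonneg (a ^ 2)]
  | succ n ih =>
    have M := af_meas h a b
    have Bd := af_bdd h a b
    have M' := af_meas h a (fun i => b i.succ)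
    have Bd' := af_bdd h a (fun i => b i.succ)
    obtain ⟨ih2, ih4⟩ := ih a (fun i => b i.succ)
    have e : ∀ t (x : Fin n → ℝ), af f1 a b (Fin.cons t x) =
        af f1 a (fun i => b i.succ) x + f1 t * b 0 + f2 t * 0 := by
      intro t x
      simp [af, Fin.sum_univ_succ]; ring
    have I2 : Integrable (fun x => af f1 a (fun i => b i.succ) x ^ 2) (Measure.pi fun _ => ν) :=
      bdd_integrable (by fun_prop) (pow_bdd Bd' 2)
    have I4 : Integrable (fun x => af f1 a (fun i => b i.succ) x ^ 4) (Measure.pi fun _ => ν) :=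
      bdd_integrable (by fun_prop) (pow_bdd Bd' 4)
    rw [integral_cons (by fun_prop) (pow_bdd Bd 2), integral_cons (by fun_prop) (pow_bdd Bd 4)]
    simp_rw [e, h.second]
    constructor
    · rw [integral_add (by fun_prop) (by fun_prop), integral_add (by fun_prop) (by fun_prop), ih2,
        Fin.sum_univ_succ]
      simp; ring
    · have step : ∫ x, (∫ t, (af f1 a (fun i => b i.succ) x + f1 t * b 0 + f2 t * 0) ^ 4 ∂ν)
            ∂(Measure.pi fun _ : Fin n => ν) ≤
          ∫ x, (af f1 a (fun i => b i.succ) x ^ 4 +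
            ((8 * b 0 ^ 2) * af f1 a (fun i => b i.succ) x ^ 2 + 600 * b 0 ^ 4))
            ∂(Measure.pi fun _ : Fin n => ν) := by
        refine integral_mono_of_nonneg (Filter.Eventually.of_forall fun x => ?_) (by fun_prop)
          (Filter.Eventually.of_forall fun x => ?_)
        · exact integral_nonneg fun t => by positivity
        · refine (h.fourth _ _ _).trans (le_of_eq ?_)
          ring
      refine step.trans ?_
      rw [integral_add (by fun_prop) (by fun_prop), integral_add (by fun_prop) (by fun_prop),
        integral_const_mul, ih2, Fin.sum_univ_succ]
      simp only [integral_const, probReal_univ, smul_eq_mul, one_mul]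
      have : 0 ≤ a ^ 2 + ∑ i : Fin n, b i.succ ^ 2 := by positivity
      nlinarith [mul_nonneg this (sq_nonneg (b 0))]

/-- squared coefficient norm -/
noncomputable def qn {n : ℕ} (a : ℝ) (b d : Fin n → ℝ) (c : Fin n → Fin n → ℝ) : ℝ :=
  a ^ 2 + ∑ i, b i ^ 2 + ∑ i, d i ^ 2 + ∑ i, ∑ j, if i < j then c i j ^ 2 else 0

lemma qn_nonneg {n : ℕ} (a : ℝ) (b d : Fin n → ℝ) (c : Fin n → Fin n → ℝ) : 0 ≤ qn a b d c := by
  have : 0 ≤ ∑ i, ∑ j, if i < j then c i j ^ 2 else 0 :=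
    Finset.sum_nonneg fun i _ => Finset.sum_nonneg fun j _ => by split_ifs <;> positivity
  unfold qn
  positivity

lemma cs_integral {α : Type*} [MeasurableSpace α] {ρ : Measure α} [IsProbabilityMeasure ρ]
    {g f : α → ℝ} (mg : Measurable g) (mf : Measurable f) (hb : ∃ C, ∀ x, |g x| ≤ C)
    (hf : ∃ C, ∀ x, |f x| ≤ C) :
    (∫ x, g x ^ 2 * f x ^ 2 ∂ρ) ^ 2 ≤ (∫ x, g x ^ 4 ∂ρ) * ∫ x, f x ^ 4 ∂ρ := by
  have Ig : Integrable (fun x => g x ^ 4) ρ := bdd_integrable (by fun_prop) (pow_bdd hb 4)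
  have If : Integrable (fun x => f x ^ 4) ρ := bdd_integrable (by fun_prop) (pow_bdd hf 4)
  have Igf : Integrable (fun x => g x ^ 2 * f x ^ 2) ρ :=
    bdd_integrable (by fun_prop) (mul_bdd (pow_bdd hb 2) (pow_bdd hf 2))
  have key : ∀ t : ℝ, 0 ≤ (∫ x, g x ^ 4 ∂ρ) * (t * t) + (-2 * ∫ x, g x ^ 2 * f x ^ 2 ∂ρ) * t +
      ∫ x, f x ^ 4 ∂ρ := by
    intro t
    have : 0 ≤ ∫ x, (t * g x ^ 2 - f x ^ 2) ^ 2 ∂ρ := integral_nonneg fun x => sq_nonneg _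
    have e : ∀ x, (t * g x ^ 2 - f x ^ 2) ^ 2 =
        (t * t) * g x ^ 4 + ((-2 * t) * (g x ^ 2 * f x ^ 2) + f x ^ 4) := fun x => by ring
    simp_rw [e] at this
    rw [integral_add (by fun_prop) (by fun_prop), integral_add (by fun_prop) (by fun_prop),
      integral_const_mul, integral_const_mul] at this
    linarith
  have := discrim_le_zero key
  unfold discrim at this
  linarith

lemma qf_moments (h : OK1 ν f1 f2) {n : ℕ} (a : ℝ) (b d : Fin n → ℝ) (c : Fin n → Fin n → ℝ) :
    ∫ x, qf f1 f2 a b d c x ^ 2 ∂(Measure.pi fun _ => ν) = qn a b d c ∧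
    ∫ x, qf f1 f2 a b d c x ^ 4 ∂(Measure.pi fun _ => ν) ≤ 360000 * (qn a b d c) ^ 2 := by
  induction n with
  | zero => simp [qf, qn]; nlinarith [sq_nonneg (a ^ 2)]
  | succ n ih =>
    have M := qf_meas h a b d c
    have Bd := qf_bdd h a b d c
    have M0 := qf_meas h a (fun i => b i.succ) (fun i => d i.succ) (fun i j => c i.succ j.succ)
    have Bd0 := qf_bdd h a (fun i => b i.succ) (fun i => d i.succ) (fun i j => c i.succ j.succ)
    have M1 := af_meas h (b 0) (fun j : Fin n => c 0 j.succ)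
    have Bd1 := af_bdd h (b 0) (fun j : Fin n => c 0 j.succ)
    obtain ⟨ih2, ih4⟩ := ih (fun i => b i.succ) (fun i => d i.succ) (fun i j => c i.succ j.succ)
    obtain ⟨ah2, ah4⟩ := af_moments h (b 0) (fun j : Fin n => c 0 j.succ)
    have CS := cs_integral (ρ := Measure.pi fun _ => ν) M0 M1 Bd0 Bd1
    have e : ∀ t (x : Fin n → ℝ), qf f1 f2 a b d c (Fin.cons t x) =
        qf f1 f2 a (fun i => b i.succ) (fun i => d i.succ) (fun i j => c i.succ j.succ) x
          + f1 t * af f1 (b 0) (fun j : Fin n => c 0 j.succ) x + f2 t * d 0 := by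
      intro t x
      simp [af, qf, Fin.sum_univ_succ, Finset.sum_add_distrib, mul_add, Finset.mul_sum]
      have : ∀ i, c 0 (Fin.succ i) * (f1 t * f1 (x i)) = f1 t * (c 0 (Fin.succ i) * f1 (x i)) :=
        fun i => by ring
      simp_rw [this]
      ring
    have eq : qn a b d c = qn a (fun i => b i.succ) (fun i => d i.succ) (fun i j => c i.succ j.succ)
        + (b 0 ^ 2 + ∑ j : Fin n, c 0 j.succ ^ 2) + d 0 ^ 2 := by
      simp [qn, Fin.sum_univ_succ, Finset.sum_add_distrib]
      ring
    have q0 := qn_nonneg a (fun i => b i.succ) (fun i => d i.succ) (fun i j => c i.succ j.succ)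
    have a0 : 0 ≤ (b 0 ^ 2 + ∑ j : Fin n, c 0 j.succ ^ 2) := by positivity
    rw [integral_cons (by fun_prop) (pow_bdd Bd 2), integral_cons (by fun_prop) (pow_bdd Bd 4), eq]
    simp_rw [e, h.second]
    set g0 := qf f1 f2 a (fun i => b i.succ) (fun i => d i.succ) (fun i j => c i.succ j.succ)
    set g1 := af f1 (b 0) (fun j : Fin n => c 0 j.succ)
    set A := qn a (fun i => b i.succ) (fun i => d i.succ) (fun i j => c i.succ j.succ)
    set B := (b 0 ^ 2 + ∑ j : Fin n, c 0 j.succ ^ 2)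
    have I2 : Integrable (fun x => g0 x ^ 2) (Measure.pi fun _ => ν) :=
      bdd_integrable (by fun_prop) (pow_bdd Bd0 2)
    have I4 : Integrable (fun x => g0 x ^ 4) (Measure.pi fun _ => ν) :=
      bdd_integrable (by fun_prop) (pow_bdd Bd0 4)
    have J2 : Integrable (fun x => g1 x ^ 2) (Measure.pi fun _ => ν) :=
      bdd_integrable (by fun_prop) (pow_bdd Bd1 2)
    have J4 : Integrable (fun x => g1 x ^ 4) (Measure.pi fun _ => ν) :=
      bdd_integrable (by fun_prop) (pow_bdd Bd1 4)
    have IJ : Integrable (fun x => g0 x ^ 2 * g1 x ^ 2) (Measure.pi fun _ => ν) :=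
      bdd_integrable (by fun_prop) (mul_bdd (pow_bdd Bd0 2) (pow_bdd Bd1 2))
    constructor
    · rw [integral_add (by fun_prop) (by fun_prop), integral_add (by fun_prop) (by fun_prop), ih2,
        ah2]
      simp
    · have step : ∫ x, (∫ t, (g0 x + f1 t * g1 x + f2 t * d 0) ^ 4 ∂ν)
            ∂(Measure.pi fun _ : Fin n => ν) ≤
          ∫ x, (g0 x ^ 4 + (8 * (g0 x ^ 2 * g1 x ^ 2) + ((8 * d 0 ^ 2) * g0 x ^ 2 +
            (600 * g1 x ^ 4 + 600 * d 0 ^ 4))))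
            ∂(Measure.pi fun _ : Fin n => ν) := by
        refine integral_mono_of_nonneg (Filter.Eventually.of_forall fun x => ?_) (by fun_prop)
          (Filter.Eventually.of_forall fun x => ?_)
        · exact integral_nonneg fun t => by positivity
        · refine (h.fourth _ _ _).trans (le_of_eq ?_)
          ring
      refine step.trans ?_
      rw [integral_add (by fun_prop) (by fun_prop), integral_add (by fun_prop) (by fun_prop),
        integral_add (by fun_prop) (by fun_prop), integral_add (by fun_prop) (by fun_prop),
        integral_const_mul, integral_const_mul, integral_const_mul, ih2]
      simp only [integral_const, probReal_univ, smul_eq_mul, one_mul]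
      have CS2 : ∫ x, g0 x ^ 2 * g1 x ^ 2 ∂(Measure.pi fun _ : Fin n => ν) ≤ 90000 * (A * B) := by
        refine le_of_sq_le_sq ?_ (by positivity)
        refine CS.trans ((mul_le_mul ih4 ah4 ?_ (by positivity)).trans ?_)
        · exact integral_nonneg fun t => by positivity
        · nlinarith [sq_nonneg (A * B)]
      nlinarith [mul_nonneg q0 (sq_nonneg (d 0)), mul_nonneg a0 (sq_nonneg (d 0)),
        sq_nonneg (d 0 ^ 2), mul_nonneg q0 a0, sq_nonneg B]

end moments

/-! ### Chernoff lower tail -/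

lemma exp_neg_le_quad {x : ℝ} (hx : 0 ≤ x) : Real.exp (-x) ≤ 1 - x + x ^ 2 / 2 := by
  have h1 := Real.quadratic_le_exp_of_nonneg hx
  have h2 : Real.exp (-x) * Real.exp x = 1 := by rw [← Real.exp_add]; simp
  have h3 : 0 < Real.exp (-x) := Real.exp_pos _
  have h4 : Real.exp (-x) * (1 + x + x ^ 2 / 2) ≤ 1 :=
    (mul_le_mul_of_nonneg_left h1 h3.le).trans h2.le
  have h5 : 0 ≤ 1 - x + x ^ 2 / 2 := by nlinarith [sq_nonneg (x - 1)]
  have h6 : 0 < 1 + x + x ^ 2 / 2 := by positivity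
  by_contra hc
  push Not at hc
  have h7 := mul_lt_mul_of_pos_right hc h6
  nlinarith [sq_nonneg (x ^ 2)]

lemma chernoff {α : Type*} [MeasurableSpace α] {ρ : Measure α} [IsProbabilityMeasure ρ]
    {X : α → ℝ} (hm : Measurable X) (h0 : ∀ x, 0 ≤ X x) (hb : ∃ C, ∀ x, |X x| ≤ C)
    {Q B : ℝ} (hQ : 0 < Q) (hB : 0 < B) (h1 : ∫ x, X x ∂ρ = Q)
    (h2 : ∫ x, X x ^ 2 ∂ρ ≤ B * Q ^ 2) (p : ℕ) :
    (Measure.pi fun _ : Fin p => ρ).real {Y | ∑ i, X (Y i) ≤ p / 2 * Q} ≤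
      Real.exp (-(p / (8 * B))) := by
  set l : ℝ := 1 / (2 * B * Q) with hl
  have lpos : 0 < l := by positivity
  have I1 : Integrable X ρ := bdd_integrable hm hb
  have I2 : Integrable (fun x => X x ^ 2) ρ := bdd_integrable (by fun_prop) (pow_bdd hb 2)
  have Ie : Integrable (fun x => Real.exp (-(l * X x))) ρ :=
    bdd_integrable (by fun_prop) ⟨1, fun x => by
      rw [abs_of_pos (Real.exp_pos _)]
      exact Real.exp_le_one_iff.2 (by have := mul_nonneg lpos.le (h0 x); linarith)⟩
  have lap : ∫ x, Real.exp (-(l * X x)) ∂ρ ≤ Real.exp (-(3 / (8 * B))) := by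
    calc ∫ x, Real.exp (-(l * X x)) ∂ρ ≤ ∫ x, (1 + ((-l) * X x + (l ^ 2 / 2) * X x ^ 2)) ∂ρ := by
          refine integral_mono Ie (by fun_prop) fun x => ?_
          refine (exp_neg_le_quad (mul_nonneg lpos.le (h0 x))).trans (le_of_eq ?_)
          ring
      _ = 1 + ((-l) * Q + (l ^ 2 / 2) * ∫ x, X x ^ 2 ∂ρ) := by
          rw [integral_add (by fun_prop) (by fun_prop), integral_add (by fun_prop) (by fun_prop),
            integral_const_mul, integral_const_mul, h1]
          simp
      _ ≤ 1 + ((-l) * Q + (l ^ 2 / 2) * (B * Q ^ 2)) := by gcongr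
      _ = -(3 / (8 * B)) + 1 := by rw [hl]; field_simp; ring
      _ ≤ _ := Real.add_one_le_exp _
  have prodI : ∫ Y : Fin p → α, ∏ i, Real.exp (-(l * X (Y i))) ∂(Measure.pi fun _ => ρ) =
      (∫ x, Real.exp (-(l * X x)) ∂ρ) ^ p := by
    rw [integral_fintype_prod_eq_prod (fun _ x => Real.exp (-(l * X x)))]
    simp
  have Ip : Integrable (fun Y : Fin p → α => ∏ i, Real.exp (-(l * X (Y i))))
      (Measure.pi fun _ => ρ) := by
    exact Integrable.fintype_prod (fun _ => Ie)
  have mk := mul_meas_ge_le_integral_of_nonneg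
    (Filter.Eventually.of_forall fun Y => Finset.prod_nonneg fun i _ => (Real.exp_pos _).le) Ip
    (Real.exp (-(l * (p / 2 * Q))))
  have sub : {Y : Fin p → α | ∑ i, X (Y i) ≤ p / 2 * Q} ⊆
      {Y | Real.exp (-(l * (p / 2 * Q))) ≤ ∏ i, Real.exp (-(l * X (Y i)))} := by
    intro Y hY
    simp only [Set.mem_ofPred_eq] at hY ⊢
    rw [← Real.exp_sum, Real.exp_le_exp, Finset.sum_neg_distrib, ← Finset.mul_sum]
    have := mul_le_mul_of_nonneg_left hY lpos.le
    linarith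
  have le1 := measureReal_mono (μ := Measure.pi fun _ : Fin p => ρ) sub
  rw [prodI] at mk
  have mk2 := mk.trans (pow_le_pow_left₀ (integral_nonneg fun x => (Real.exp_pos _).le) lap p)
  rw [← Real.exp_nat_mul] at mk2
  have e : (p : ℝ) * -(3 / (8 * B)) = -(l * (p / 2 * Q)) + -(p / (8 * B)) := by
    rw [hl]; field_simp; ring
  rw [e, Real.exp_add] at mk2
  exact le1.trans (le_of_mul_le_mul_left mk2 (Real.exp_pos _))

/-! ### Maurey's empirical method -/

lemma exists_le_avg {K : Type*} [Fintype K] {w F : K → ℝ} (hw : ∀ k, 0 ≤ w k)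
    (h1 : ∑ k, w k = 1) {T : ℝ} (hT : ∑ k, w k * F k ≤ T) : ∃ k, F k ≤ T := by
  by_contra hc
  push Not at hc
  obtain ⟨k, -, hk⟩ := Finset.exists_ne_zero_of_sum_ne_zero (s := Finset.univ) (f := w)
    (by rw [h1]; norm_num)
  have : ∑ k, w k * T < ∑ k, w k * F k :=
    Finset.sum_lt_sum (fun i _ => mul_le_mul_of_nonneg_left (hc i).le (hw i))
      ⟨k, Finset.mem_univ _, mul_lt_mul_of_pos_left (hc k) (lt_of_le_of_ne (hw k) hk.symm)⟩
  rw [← Finset.sum_mul, h1] at this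
  linarith

lemma maurey {K ι : Type*} [Fintype K] [Fintype ι] {w : K → ℝ} (hw : ∀ k, 0 ≤ w k)
    (h1 : ∑ k, w k = 1) (g : ι → ℝ) (hg : ∀ l, 0 ≤ g l) (v : K → ι → ℝ) (x : ι → ℝ)
    (hx : ∀ l, ∑ k, w k * v k l = x l) (R : ℝ) (hR : ∀ k, ∑ l, g l * v k l ^ 2 ≤ R) (m : ℕ) :
    ∃ s : Fin m → K, ∑ l, g l * (∑ i, v (s i) l - m * x l) ^ 2 ≤ m * R := by
  induction m with
  | zero => exact ⟨Fin.elim0, by simp⟩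
  | succ m ih =>
    obtain ⟨s, hs⟩ := ih
    have avg : ∑ k, w k * ∑ l, g l * ((∑ i, v (s i) l - m * x l) + (v k l - x l)) ^ 2 ≤
        (m + 1) * R := by
      have e : ∑ k, w k * ∑ l, g l * ((∑ i, v (s i) l - m * x l) + (v k l - x l)) ^ 2 =
          ∑ l, g l * (∑ i, v (s i) l - m * x l) ^ 2 + ∑ k, w k * ∑ l, g l * v k l ^ 2
            - ∑ l, g l * x l ^ 2 := by
        simp_rw [Finset.mul_sum]
        rw [Finset.sum_comm, Finset.sum_comm (s := Finset.univ (α := K)), ← Finset.sum_add_distrib,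
          ← Finset.sum_sub_distrib]
        refine Finset.sum_congr rfl fun l _ => ?_
        set S := ∑ i, v (s i) l - m * x l
        have e1 : ∀ k, w k * (g l * (S + (v k l - x l)) ^ 2) =
          g l * (S - x l) ^ 2 * w k + 2 * g l * (S - x l) * (w k * v k l)
            + w k * (g l * v k l ^ 2) := fun k => by ring
        simp_rw [e1, Finset.sum_add_distrib, ← Finset.mul_sum, h1, hx]
        ring
      have e2 : ∑ k, w k * ∑ l, g l * v k l ^ 2 ≤ R := by
        calc _ ≤ ∑ k, w k * R := Finset.sum_le_sum fun k _ =>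
              mul_le_mul_of_nonneg_left (hR k) (hw k)
          _ = R := by rw [← Finset.sum_mul, h1, one_mul]
      have e3 : 0 ≤ ∑ l, g l * x l ^ 2 :=
        Finset.sum_nonneg fun l _ => mul_nonneg (hg l) (sq_nonneg _)
      rw [e]
      linarith
    obtain ⟨k, hk⟩ := exists_le_avg hw h1 avg
    refine ⟨Fin.cons k s, ?_⟩
    push_cast
    refine le_trans (le_of_eq ?_) hk
    refine Finset.sum_congr rfl fun l _ => ?_
    simp only [Fin.sum_univ_succ, Fin.cons_zero, Fin.cons_succ]
    ring

/-- sign -/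
def sg (b : Bool) : ℝ := if b then 1 else -1

lemma sg_sq (b : Bool) : sg b ^ 2 = 1 := by cases b <;> simp [sg]

lemma sg_abs (x : ℝ) : |x| * sg (decide (0 ≤ x)) = x := by
  by_cases h : 0 ≤ x
  · simp [sg, h]
  · simp [sg, h, abs_of_neg (not_le.1 h)]

open scoped Classical in
/-- integer vector attached to a word of signed indices -/
noncomputable def uvec {J : Type*} {m : ℕ} (k : Fin m → J × Bool) (j : J) : ℝ :=
  ∑ i, if (k i).1 = j then sg (k i).2 else 0

lemma sum_mul_uvec {J : Type*} [Fintype J] {m : ℕ} (k : Fin m → J × Bool) (a : J → ℝ) :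
    ∑ j, a j * uvec k j = ∑ i, a (k i).1 * sg (k i).2 := by
  classical
  unfold uvec
  simp_rw [Finset.mul_sum]
  rw [Finset.sum_comm]
  refine Finset.sum_congr rfl fun i _ => ?_
  simp

lemma lower_bound {J : Type*} [Fintype J] {p m s : ℕ} (A : Fin p → J → ℝ)
    (hA : ∀ i j, |A i j| ≤ 3) (hs : 0 < s) (hm : m = 1000 * s)
    (good : ∀ k : Fin m → J × Bool,
      (p : ℝ) / 2 * ∑ j, uvec k j ^ 2 ≤ ∑ i, (∑ j, A i j * uvec k j) ^ 2)
    (z : J → ℝ) (hz : (∑ j, |z j|) ^ 2 ≤ 4 * s * ∑ j, z j ^ 2) :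
    (p : ℝ) / 16 * ∑ j, z j ^ 2 ≤ ∑ i, (∑ j, A i j * z j) ^ 2 := by
  classical
  rcases (Finset.sum_nonneg fun j (_ : j ∈ Finset.univ) => abs_nonneg (z j)).eq_or_lt with hL | hL
  · have : ∀ j, z j = 0 := by
      intro j
      have := (Finset.sum_eq_zero_iff_of_nonneg (fun j _ => abs_nonneg (z j))).1 hL.symm j
        (Finset.mem_univ _)
      exact abs_eq_zero.1 this
    simp [this]
  set L := ∑ j, |z j| with hLdef
  set N := ∑ j, z j ^ 2 with hN
  let σ : J → ℝ := fun j => sg (decide (0 ≤ z j))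
  let v : J → J ⊕ Fin p → ℝ := fun j => Sum.elim (fun l => L * (if j = l then σ j else 0))
    (fun r => L * (A r j * σ j))
  let x : J ⊕ Fin p → ℝ := Sum.elim z (fun r => ∑ j, A r j * z j)
  let g : J ⊕ Fin p → ℝ := Sum.elim (fun _ => p) (fun _ => 1)
  obtain ⟨t, ht⟩ := maurey (w := fun j => |z j| / L) (fun j => by positivity)
    (by rw [← Finset.sum_div, div_self hL.ne']) g
    (by rintro (l | l) <;> simp [g]) v x
    (by
      rintro (l | r)
      · simp only [v, x, Sum.elim_inl]
        have : ∀ j, |z j| / L * (L * (if j = l then σ j else 0)) = if j = l then z j else 0 := by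
          intro j
          split_ifs
          · rw [← mul_assoc, div_mul_cancel₀ _ hL.ne', sg_abs]
          · simp
        simp_rw [this]
        simp
      · simp only [v, x, Sum.elim_inr]
        refine Finset.sum_congr rfl fun j _ => ?_
        rw [← mul_assoc, div_mul_cancel₀ _ hL.ne', mul_left_comm, sg_abs])
    (10 * p * L ^ 2)
    (by
      intro k
      rw [Fintype.sum_sum_type]
      simp only [g, v, Sum.elim_inl, Sum.elim_inr]
      have e1 : ∀ l, (p : ℝ) * (L * (if k = l then σ k else 0)) ^ 2 =
          if k = l then (p : ℝ) * L ^ 2 else 0 := by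
        intro l
        split_ifs
        · rw [mul_pow, sg_sq]; ring
        · simp
      simp_rw [e1]
      have e2 : ∑ r, 1 * (L * (A r k * σ k)) ^ 2 ≤ ∑ r : Fin p, 9 * L ^ 2 := by
        refine Finset.sum_le_sum fun r _ => ?_
        rw [mul_pow, mul_pow, sg_sq]
        have : A r k ^ 2 ≤ 9 := by
          have := hA r k
          rw [← sq_abs]; nlinarith [abs_nonneg (A r k)]
        nlinarith [sq_nonneg L]
      simp at e2 ⊢
      linarith) m
  rw [Fintype.sum_sum_type] at ht
  simp only [g, v, x, Sum.elim_inl, Sum.elim_inr] at ht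
  set k : Fin m → J × Bool := fun i => (t i, decide (0 ≤ z (t i))) with hk
  have eu : ∀ l, ∑ i, L * (if t i = l then σ (t i) else 0) = L * uvec k l := by
    intro l
    rw [← Finset.mul_sum]
    rfl
  have ev : ∀ r, ∑ i, L * (A r (t i) * σ (t i)) = L * ∑ j, A r j * uvec k j := by
    intro r
    rw [← Finset.mul_sum, sum_mul_uvec]
  simp_rw [eu, ev] at ht
  rw [← Finset.mul_sum] at ht
  have hgood := good k
  set E1 := ∑ l, (L * uvec k l - m * z l) ^ 2
  set E2' := ∑ r, 1 * (L * ∑ j, A r j * uvec k j - m * ∑ j, A r j * z j) ^ 2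
  have b1 : (m : ℝ) ^ 2 * N ≤ 2 * (L ^ 2 * ∑ j, uvec k j ^ 2) + 2 * E1 := by
    simp only [hN, E1, Finset.mul_sum, ← Finset.sum_add_distrib]
    refine Finset.sum_le_sum fun j _ => ?_
    nlinarith [sq_nonneg (2 * (L * uvec k j) - m * z j)]
  have b2 : L ^ 2 * ∑ i, (∑ j, A i j * uvec k j) ^ 2 ≤
      2 * ((m : ℝ) ^ 2 * ∑ i, (∑ j, A i j * z j) ^ 2) + 2 * E2' := by
    simp only [E2', Finset.mul_sum (s := (Finset.univ : Finset (Fin p))), ← Finset.sum_add_distrib]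
    refine Finset.sum_le_sum fun r _ => ?_
    nlinarith [sq_nonneg (L * (∑ j, A r j * uvec k j) - 2 * (m * ∑ j, A r j * z j))]
  have hE1 : 0 ≤ E1 := by positivity
  have hE2 : 0 ≤ E2' := Finset.sum_nonneg fun _ _ => by positivity
  have hp : (0 : ℝ) ≤ p := by positivity
  have hmm : (m : ℝ) = 1000 * s := by rw [hm]; push_cast; ring
  have hmpos : (0 : ℝ) < m := by rw [hmm]; positivity
  have hN0 : 0 ≤ N := by positivity
  have h3 : (m : ℝ) * (10 * p * L ^ 2) ≤ 4 / 100 * (p * (m ^ 2 * N)) := by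
    have := mul_le_mul_of_nonneg_left hz (mul_nonneg hmpos.le hp)
    have e : (m : ℝ) * p * (4 * s * N) = 4 / 1000 * (p * (m ^ 2 * N)) := by rw [hmm]; ring
    nlinarith
  have h4 := mul_le_mul_of_nonneg_left hgood (sq_nonneg L)
  have h5 := mul_le_mul_of_nonneg_left b1 hp
  have h6 : (m : ℝ) ^ 2 * ((p : ℝ) / 16 * N) ≤ m ^ 2 * ∑ i, (∑ j, A i j * z j) ^ 2 := by
    have : 0 ≤ (p : ℝ) * E1 := by positivity
    have : 0 ≤ (p : ℝ) * (m ^ 2 * N) := by positivity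
    linarith
  exact le_of_mul_le_mul_left h6 (by positivity)

/-! ### The cone condition -/

lemma cone {Q Λ : Type*} [Fintype Q] [Fintype Λ] {h : ℕ} (zb x : Q → ℝ) (y : Λ → ℝ)
    (hsp : Sparse h zb) (hl : l1 (fun j => zb j + x j) ≤ l1 zb) :
    (∑ j, |x j| + ∑ j, |y j|) ^ 2 ≤
      4 * (h + Fintype.card Λ : ℕ) * (∑ j, x j ^ 2 + ∑ j, y j ^ 2) := by
  classical
  set T : Finset Q := Finset.univ.filter (fun j => zb j ≠ 0) with hT
  have cT : T.card ≤ h := by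
    unfold Sparse card' at hsp
    rw [Nat.card_eq_fintype_card, Fintype.card_subtype] at hsp
    convert hsp
  have h1 : ∑ j, |x j| ≤ 2 * ∑ j ∈ T, |x j| := by
    have pt : ∀ j, |zb j| + |x j| - 2 * (if zb j ≠ 0 then |x j| else 0) ≤ |zb j + x j| := by
      intro j
      split_ifs with hj
      · have := abs_sub_abs_le_abs_sub (zb j) (-x j)
        rw [abs_neg, sub_neg_eq_add] at this
        linarith
      · push Not at hj
        simp [hj]
    have := Finset.sum_le_sum fun j (_ : j ∈ Finset.univ) => pt j
    rw [Finset.sum_sub_distrib, Finset.sum_add_distrib, ← Finset.mul_sum, ← Finset.sum_filter] at this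
    unfold l1 at hl
    linarith
  have h2 : (∑ j ∈ T, |x j|) ^ 2 ≤ h * ∑ j, x j ^ 2 := by
    calc (∑ j ∈ T, |x j|) ^ 2 ≤ T.card * ∑ j ∈ T, |x j| ^ 2 := sq_sum_le_card_mul_sum_sq
      _ ≤ h * ∑ j, |x j| ^ 2 := by
        gcongr
        exact Finset.subset_univ _
      _ = _ := by simp
  have h3 : (∑ j, |y j|) ^ 2 ≤ Fintype.card Λ * ∑ j, y j ^ 2 := by
    calc (∑ j, |y j|) ^ 2 ≤ (Finset.univ : Finset Λ).card * ∑ j, |y j| ^ 2 :=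
          sq_sum_le_card_mul_sum_sq
      _ = _ := by simp
  have p0 : 0 ≤ ∑ j ∈ T, |x j| := by positivity
  have r0 : 0 ≤ ∑ j, |y j| := by positivity
  have x0 : 0 ≤ ∑ j, |x j| := by positivity
  have nx : 0 ≤ ∑ j, x j ^ 2 := by positivity
  have ny : 0 ≤ ∑ j, y j ^ 2 := by positivity
  push_cast
  set P := ∑ j ∈ T, |x j|
  set R := ∑ j, |y j|
  set X := ∑ j, |x j|
  set a := ∑ j, x j ^ 2
  set b := ∑ j, y j ^ 2
  set H : ℝ := (h : ℝ)
  set K : ℝ := (Fintype.card Λ : ℝ)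
  have H0 : 0 ≤ H := by positivity
  have K0 : 0 ≤ K := by positivity
  have h4 : 2 * P * R ≤ H * b + K * a := by
    refine le_of_sq_le_sq ?_ (by positivity)
    have := mul_le_mul h2 h3 (sq_nonneg _) (by positivity)
    nlinarith [sq_nonneg (H * b - K * a)]
  have h5 : (X + R) ^ 2 ≤ (2 * P + 2 * R) ^ 2 := pow_le_pow_left₀ (by positivity) (by linarith) 2
  nlinarith

/-! ### Instantiation on the hypercube -/

/-- projection to `[-Δ, Δ]` -/
noncomputable def pr (Δ t : ℝ) : ℝ := max (-Δ) (min Δ t)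

lemma pr_abs {Δ : ℝ} (hΔ : 0 < Δ) (t : ℝ) : |pr Δ t| ≤ Δ := by
  unfold pr
  rw [abs_le]
  exact ⟨le_max_left _ _, max_le (by linarith) (min_le_left _ _)⟩

lemma pr_sq {Δ : ℝ} (hΔ : 0 < Δ) (t : ℝ) : pr Δ t ^ 2 ≤ Δ ^ 2 :=
  sq_le_sq' (abs_le.1 (pr_abs hΔ t)).1 (abs_le.1 (pr_abs hΔ t)).2

lemma pr_eq {Δ t : ℝ} (ht : |t| ≤ Δ) : pr Δ t = t := by
  unfold pr
  rw [abs_le] at ht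
  rw [min_eq_right ht.2, max_eq_right ht.1]

lemma pr_meas (Δ : ℝ) : Measurable (pr Δ) := by
  unfold pr
  fun_prop

/-- normalized linear function -/
noncomputable def F1 (Δ t : ℝ) : ℝ := Real.sqrt 3 / Δ * pr Δ t
/-- normalized quadratic function -/
noncomputable def F2 (Δ t : ℝ) : ℝ := 3 * Real.sqrt 5 / (2 * Δ ^ 2) * pr Δ t ^ 2 - Real.sqrt 5 / 2

/-- uniform measure on the interval -/
noncomputable def nu (Δ : ℝ) : Measure ℝ :=
  (ENNReal.ofReal (2 * Δ))⁻¹ • volume.restrict (Set.Icc (-Δ) Δ)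

lemma nu_prob {Δ : ℝ} (hΔ : 0 < Δ) : IsProbabilityMeasure (nu Δ) := by
  constructor
  simp only [nu, Measure.smul_apply, Measure.restrict_apply_univ, Real.volume_Icc, smul_eq_mul]
  rw [show Δ - -Δ = 2 * Δ by ring]
  exact ENNReal.inv_mul_cancel (by simp [hΔ]) ENNReal.ofReal_ne_top

lemma mu_eq {n : ℕ} {Δ : ℝ} (hΔ : 0 < Δ) : mu n Δ = Measure.pi (fun _ : Fin n => nu Δ) := by
  have := nu_prob hΔ
  symm
  refine Measure.pi_eq fun s hs => ?_
  simp only [mu, nu, Measure.smul_apply, smul_eq_mul, Measure.pi_pi, Finset.prod_mul_distrib,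
    Finset.prod_const, Finset.card_univ, Fintype.card_fin]
  rw [ENNReal.ofReal_pow (by positivity), ENNReal.inv_pow]

lemma nu_integral {Δ : ℝ} (hΔ : 0 < Δ) (G : ℝ → ℝ) :
    ∫ t, G (pr Δ t) ∂(nu Δ) = (2 * Δ)⁻¹ * ∫ t in (-Δ)..Δ, G t := by
  rw [nu, integral_smul_measure, intervalIntegral.integral_of_le (by linarith),
    ← integral_Icc_eq_integral_Ioc]
  rw [ENNReal.toReal_inv, ENNReal.toReal_ofReal (by positivity), smul_eq_mul]
  congr 1
  refine setIntegral_congr_fun measurableSet_Icc fun t ht => ?_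
  simp only [pr_eq (abs_le.2 ht)]

lemma ok1 {Δ : ℝ} (hΔ : 0 < Δ) : OK1 (nu Δ) (F1 Δ) (F2 Δ) := by
  have s3 : Real.sqrt 3 ^ 2 = 3 := Real.sq_sqrt (by norm_num)
  have s5 : Real.sqrt 5 ^ 2 = 5 := Real.sq_sqrt (by norm_num)
  have pm := pr_meas Δ
  refine ⟨?_, ?_, ?_, ?_, ?_, ?_, ?_, ?_, ?_⟩
  · unfold F1; fun_prop
  · unfold F2; fun_prop
  · intro t
    have : F1 Δ t ^ 2 = 3 * (pr Δ t ^ 2 / Δ ^ 2) := by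
      unfold F1; rw [mul_pow, div_pow, s3]; ring
    rw [this]
    have : pr Δ t ^ 2 / Δ ^ 2 ≤ 1 := (div_le_one (by positivity)).2 (pr_sq hΔ t)
    linarith
  · intro t
    have : F2 Δ t ^ 2 = 5 / 4 * (3 * (pr Δ t ^ 2 / Δ ^ 2) - 1) ^ 2 := by
      have : F2 Δ t = Real.sqrt 5 * (1 / 2 * (3 * (pr Δ t ^ 2 / Δ ^ 2) - 1)) := by
        unfold F2; field_simp
      rw [this, mul_pow, s5]; ring
    rw [this]
    have h1 : pr Δ t ^ 2 / Δ ^ 2 ≤ 1 := (div_le_one (by positivity)).2 (pr_sq hΔ t)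
    have h0 : 0 ≤ pr Δ t ^ 2 / Δ ^ 2 := by positivity
    nlinarith
  · unfold F1
    rw [nu_integral hΔ (fun t => Real.sqrt 3 / Δ * t)]
    rw [intervalIntegral.integral_const_mul, integral_id]
    ring
  · unfold F2
    rw [nu_integral hΔ (fun t => 3 * Real.sqrt 5 / (2 * Δ ^ 2) * t ^ 2 - Real.sqrt 5 / 2)]
    rw [intervalIntegral.integral_sub (by apply Continuous.intervalIntegrable; fun_prop) (by simp)]
    rw [intervalIntegral.integral_const_mul, integral_pow, intervalIntegral.integral_const,
      smul_eq_mul]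
    push_cast
    field_simp
    ring
  · unfold F1 F2
    rw [nu_integral hΔ (fun t => Real.sqrt 3 / Δ * t *
      (3 * Real.sqrt 5 / (2 * Δ ^ 2) * t ^ 2 - Real.sqrt 5 / 2))]
    have : ∀ t : ℝ, Real.sqrt 3 / Δ * t * (3 * Real.sqrt 5 / (2 * Δ ^ 2) * t ^ 2 - Real.sqrt 5 / 2) =
      (Real.sqrt 3 / Δ * (3 * Real.sqrt 5 / (2 * Δ ^ 2))) * t ^ 3
        - (Real.sqrt 3 / Δ * (Real.sqrt 5 / 2)) * t := fun t => by ring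
    simp_rw [this]
    rw [intervalIntegral.integral_sub (by apply Continuous.intervalIntegrable; fun_prop)
      (by apply Continuous.intervalIntegrable; fun_prop)]
    rw [intervalIntegral.integral_const_mul, intervalIntegral.integral_const_mul, integral_pow,
      integral_id]
    push_cast
    ring
  · unfold F1
    rw [nu_integral hΔ (fun t => (Real.sqrt 3 / Δ * t) ^ 2)]
    simp_rw [mul_pow, div_pow, s3]
    simp
    field_simp
    ring
  · unfold F2
    rw [nu_integral hΔ (fun t => (3 * Real.sqrt 5 / (2 * Δ ^ 2) * t ^ 2 - Real.sqrt 5 / 2) ^ 2)]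
    have : ∀ t : ℝ, (3 * Real.sqrt 5 / (2 * Δ ^ 2) * t ^ 2 - Real.sqrt 5 / 2) ^ 2 =
      (45 / (4 * Δ ^ 4)) * t ^ 4 - (15 / (2 * Δ ^ 2)) * t ^ 2 + 5 / 4 := fun t => by
        have : (3 * Real.sqrt 5 / (2 * Δ ^ 2) * t ^ 2 - Real.sqrt 5 / 2) ^ 2 =
          Real.sqrt 5 ^ 2 * (3 / (2 * Δ ^ 2) * t ^ 2 - 1 / 2) ^ 2 := by ring
        rw [this, s5]; field_simp; ring
    simp_rw [this]
    rw [intervalIntegral.integral_add (by apply Continuous.intervalIntegrable; fun_prop)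
      (by apply Continuous.intervalIntegrable; fun_prop),
      intervalIntegral.integral_sub (by apply Continuous.intervalIntegrable; fun_prop)
      (by apply Continuous.intervalIntegrable; fun_prop)]
    simp
    field_simp
    ring

/-- clamped basis -/
noncomputable def psi' (n : ℕ) (Δ : ℝ) (j : Idx n) (x : Fin n → ℝ) : ℝ :=
  psi n Δ j (fun i => pr Δ (x i))

lemma psi'_abs {n : ℕ} {Δ : ℝ} (hΔ : 0 < Δ) (j : Idx n) (x : Fin n → ℝ) : |psi' n Δ j x| ≤ 3 := by
  have ok := ok1 hΔ
  rcases j with (i | p) | (i | _)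
  · refine abs_le_of_sq_le_sq ?_ (by norm_num)
    have := ok.bd2 (x i)
    unfold F2 at this
    simp only [psi', psi]
    linarith
  · simp only [psi', psi]
    rw [abs_mul, abs_mul, abs_of_pos (by positivity)]
    have h1 := pr_abs hΔ (x p.1.1)
    have h2 := pr_abs hΔ (x p.1.2)
    have : |pr Δ (x p.1.1)| * |pr Δ (x p.1.2)| ≤ Δ * Δ :=
      mul_le_mul h1 h2 (abs_nonneg _) hΔ.le
    rw [div_mul_eq_mul_div, div_le_iff₀ (by positivity)]
    nlinarith
  · refine abs_le_of_sq_le_sq ?_ (by norm_num)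
    have := ok.bd1 (x i)
    unfold F1 at this
    simp only [psi', psi]
    linarith
  · simp [psi', psi]

lemma sum_pairs {n : ℕ} (G : Pairs n → ℝ) :
    ∑ q : Pairs n, G q = ∑ i, ∑ j, if h : i < j then G ⟨(i, j), h⟩ else 0 := by
  rw [← Fintype.sum_prod_type' (f := fun i j => if h : i < j then G ⟨(i, j), h⟩ else 0)]
  have h1 := Finset.sum_subtype (F := inferInstance) (p := fun q : Fin n × Fin n => q.1 < q.2)
    (Finset.univ.filter (fun q : Fin n × Fin n => q.1 < q.2)) (by simp)
    (fun q => if h : q.1 < q.2 then G ⟨(q.1, q.2), h⟩ else 0)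
  have h2 : ∑ q : Pairs n, G q =
      ∑ q : Pairs n, (if h : q.1.1 < q.1.2 then G ⟨(q.1.1, q.1.2), h⟩ else 0) :=
    Finset.sum_congr rfl fun q _ => by rw [dif_pos q.2]
  rw [h2]
  refine h1.symm.trans ?_
  rw [Finset.sum_filter]
  refine Finset.sum_congr rfl fun q _ => ?_
  split_ifs <;> rfl

lemma psi'_sum {n : ℕ} {Δ : ℝ} (z : Idx n → ℝ) :
    ∃ (a : ℝ) (b d : Fin n → ℝ) (c : Fin n → Fin n → ℝ),
      (∀ x, ∑ j, psi' n Δ j x * z j = qf (F1 Δ) (F2 Δ) a b d c x) ∧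
      ∑ j, z j ^ 2 = qn a b d c := by
  refine ⟨z (Sum.inr (Sum.inr ())), fun i => z (Sum.inr (Sum.inl i)),
    fun i => z (Sum.inl (Sum.inl i)),
    fun i j => if h : i < j then z (Sum.inl (Sum.inr ⟨(i, j), h⟩)) else 0, ?_, ?_⟩
  · intro x
    simp only [Fintype.sum_sum_type, sum_pairs, qf, psi', psi]
    have e : ∀ i j : Fin n, (if h : i < j then 3 / Δ ^ 2 * (pr Δ (x i) * pr Δ (x j)) *
          z (Sum.inl (Sum.inr ⟨(i, j), h⟩)) else 0) =
        if i < j then (if h : i < j then z (Sum.inl (Sum.inr ⟨(i, j), h⟩)) else 0) *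
          (F1 Δ (x i) * F1 Δ (x j)) else 0 := by
      intro i j
      split_ifs
      · have s3 : Real.sqrt 3 ^ 2 = 3 := Real.sq_sqrt (by norm_num)
        have : F1 Δ (x i) * F1 Δ (x j) = 3 / Δ ^ 2 * (pr Δ (x i) * pr Δ (x j)) := by
          have : F1 Δ (x i) * F1 Δ (x j) = Real.sqrt 3 ^ 2 / Δ ^ 2 * (pr Δ (x i) * pr Δ (x j)) := by
            unfold F1
            ring
          rw [this, s3]
        rw [this]; ring
      · rfl
    simp_rw [e]
    simp [F1, F2, mul_comm]
    ring
  · simp only [Fintype.sum_sum_type, sum_pairs, qn]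
    have e : ∀ i j : Fin n, (if h : i < j then z (Sum.inl (Sum.inr ⟨(i, j), h⟩)) ^ 2 else 0) =
        if i < j then (if h : i < j then z (Sum.inl (Sum.inr ⟨(i, j), h⟩)) else 0) ^ 2 else 0 := by
      intro i j
      split_ifs <;> rfl
    simp_rw [e]
    simp
    ring

lemma tail_one {n : ℕ} {Δ : ℝ} (hΔ : 0 < Δ) (z : Idx n → ℝ) (p : ℕ) :
    (Measure.pi fun _ : Fin p => mu n Δ).real
      {Y | ¬ ((p : ℝ) / 2 * ∑ j, z j ^ 2 ≤ ∑ i, (∑ j, psi' n Δ j (Y i) * z j) ^ 2)} ≤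
      Real.exp (-(p / 2880000)) := by
  have := nu_prob hΔ
  have ok := ok1 hΔ
  rw [mu_eq hΔ]
  obtain ⟨a, b, d, c, h1, h2⟩ := psi'_sum (Δ := Δ) z
  simp_rw [h1, h2]
  obtain ⟨m2, m4⟩ := qf_moments ok a b d c
  have M := qf_meas ok a b d c
  rcases (qn_nonneg a b d c).eq_or_lt with h0 | h0
  · have : {Y : Fin p → Fin n → ℝ | ¬ ((p : ℝ) / 2 * qn a b d c ≤
        ∑ i, qf (F1 Δ) (F2 Δ) a b d c (Y i) ^ 2)} = ∅ := by
      rw [← h0]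
      ext Y
      simp
      positivity
    rw [this]
    simp
    positivity
  · have := chernoff (X := fun x => qf (F1 Δ) (F2 Δ) a b d c x ^ 2) (by fun_prop)
      (fun x => sq_nonneg _) (pow_bdd (qf_bdd ok a b d c) 2) h0 (B := 360000) (by norm_num) m2
      (by simpa [← pow_mul] using m4) p
    refine (measureReal_mono ?_).trans (this.trans (le_of_eq ?_))
    · intro Y hY
      simp only [Set.mem_ofPred_eq, not_le] at hY ⊢
      exact hY.le
    · norm_num

lemma ae_cube {n p : ℕ} {Δ : ℝ} (hΔ : 0 < Δ) :
    ∀ᵐ Y ∂(Measure.pi fun _ : Fin p => mu n Δ), ∀ i k, |Y i k| ≤ Δ := by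
  have := nu_prob hΔ
  rw [mu_eq hΔ]
  have h1 : ∀ᵐ t ∂(nu Δ), |t| ≤ Δ := by
    unfold nu
    refine Measure.ae_smul_measure ?_ _
    filter_upwards [ae_restrict_mem measurableSet_Icc] with t ht
    exact abs_le.2 ht
  have h2 : ∀ᵐ x ∂(Measure.pi fun _ : Fin n => nu Δ), ∀ k, |x k| ≤ Δ := by
    rw [ae_all_iff]
    intro k
    exact (Measure.tendsto_eval_ae_ae (μ := fun _ : Fin n => nu Δ) (i := k)).eventually h1
  rw [ae_all_iff]
  intro i
  exact (Measure.tendsto_eval_ae_ae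
    (μ := fun _ : Fin p => Measure.pi fun _ : Fin n => nu Δ) (i := i)).eventually h2

lemma card_Idx_le (n : ℕ) (hn : 2 ≤ n) :
    2 * Fintype.card (Idx n) ≤ ((n + 1) * (n + 2) / 2) ^ 2 := by
  have h1 : Fintype.card (Pairs n) ≤ n * n := by
    refine (Fintype.card_subtype_le _).trans ?_
    simp
  have h2 : 2 * (n + 1) ≤ (n + 1) * (n + 2) / 2 := by
    rw [Nat.le_div_iff_mul_le (by norm_num)]
    nlinarith
  have h3 : Fintype.card (Idx n) = n + Fintype.card (Pairs n) + (n + 1) := by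
    simp only [Idx, QIdx, LIdx, Fintype.card_sum, Fintype.card_fin, Fintype.card_unit]
  have h4 := Nat.pow_le_pow_left h2 2
  rw [h3]
  nlinarith

lemma numeric (n : ℕ) (hn : 2 ≤ n) (h p : ℕ) (h1 : 1 ≤ h)
    (H : 9 * (10 ^ 11 : ℝ) * ((h : ℝ) + n + 1) * Real.log ((h : ℝ) + n + 1) ^ 2 *
          Real.log ((n + 1) * (n + 2) / 2 : ℕ) ≤ (p : ℝ) / Real.log p) :
    2 ≤ p ∧ ((2 * Fintype.card (Idx n) : ℕ) : ℝ) ^ (1000 * (h + n + 1)) *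
      Real.exp (-(p / 2880000)) ≤ (n : ℝ) ^ (-(1 * Real.log p)) := by
  have hc := card_Idx_le n hn
  have hq : n ≤ (n + 1) * (n + 2) / 2 := by
    rw [Nat.le_div_iff_mul_le (by norm_num)]
    nlinarith
  set q : ℕ := (n + 1) * (n + 2) / 2 with hqdef
  have hnr : (2 : ℝ) ≤ n := by exact_mod_cast hn
  have hhr : (1 : ℝ) ≤ h := by exact_mod_cast h1
  have hqr : (n : ℝ) ≤ q := by exact_mod_cast hq
  have hln : 0 < Real.log n := Real.log_pos (by linarith)
  have hlq : Real.log n ≤ Real.log q := Real.log_le_log (by linarith) hqr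
  have hls : 1 ≤ Real.log ((h : ℝ) + n + 1) := by
    rw [Real.le_log_iff_exp_le (by positivity)]
    linarith [Real.exp_one_lt_d9]
  have hls2 : 1 ≤ Real.log ((h : ℝ) + n + 1) ^ 2 := one_le_pow₀ hls
  set s : ℝ := (h : ℝ) + n + 1 with hs
  have s1 : 4 ≤ s := by linarith
  have lq0 : 0 < Real.log q := by linarith
  have H2 : 9 * (10 ^ 11 : ℝ) * s * Real.log q ≤ p / Real.log p := by
    refine le_trans ?_ H
    have : 0 ≤ 9 * (10 ^ 11 : ℝ) * s * Real.log q := by positivity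
    nlinarith
  have hp : 2 ≤ p := by
    by_contra hp
    have : p = 0 ∨ p = 1 := by omega
    have : (p : ℝ) / Real.log p = 0 := by rcases this with rfl | rfl <;> simp
    rw [this] at H2
    have : 0 < 9 * (10 ^ 11 : ℝ) * s * Real.log q := by positivity
    linarith
  refine ⟨hp, ?_⟩
  have hpr : (2 : ℝ) ≤ p := by exact_mod_cast hp
  have hlp : (1 : ℝ) / 2 ≤ Real.log p := by
    have := Real.log_le_log (by norm_num) hpr
    linarith [Real.log_two_gt_d9]
  rw [le_div_iff₀ (by linarith)] at H2
  have hcr : ((2 * Fintype.card (Idx n) : ℕ) : ℝ) ≤ Real.exp (2 * Real.log q) := by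
    rw [two_mul (Real.log q), Real.exp_add, Real.exp_log (by linarith), ← sq]
    exact_mod_cast hc
  calc _ ≤ Real.exp (2 * Real.log q) ^ (1000 * (h + n + 1)) * Real.exp (-(p / 2880000)) := by
        gcongr
    _ = Real.exp (2000 * s * Real.log q - p / 2880000) := by
        rw [← Real.exp_nat_mul, ← Real.exp_add]
        congr 1
        push_cast
        rw [hs]; ring
    _ ≤ Real.exp (Real.log n * (-(1 * Real.log p))) := by
        rw [Real.exp_le_exp]
        have a1 : s * Real.log q * (1 / 2) ≤ s * Real.log q * Real.log p :=
          mul_le_mul_of_nonneg_left hlp (by positivity)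
        have a2 : Real.log n * Real.log p ≤ s * Real.log q * Real.log p := by
          refine mul_le_mul_of_nonneg_right ?_ (by linarith)
          nlinarith
        have a3 : 0 ≤ s * Real.log q := by positivity
        have a4 : 0 ≤ s * Real.log q * Real.log p := mul_nonneg a3 (by linarith)
        nlinarith
    _ = _ := by rw [Real.rpow_def_of_pos (by linarith)]

lemma l2_sq {ι : Type*} [Fintype ι] (v : ι → ℝ) : l2 v ^ 2 = ∑ i, v i ^ 2 :=
  Real.sq_sqrt (by positivity)

lemma l2_nonneg {ι : Type*} [Fintype ι] (v : ι → ℝ) : 0 ≤ l2 v := Real.sqrt_nonneg _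

open scoped Classical in
/-- (Corollary: partially sparse noisy recovery in the basis `ψ` on the
hypercube.) There are universal constants `c, γ, c_partial > 0` such that for `n ≥ 2`, `Δ > 0`,
`q = (n+1)(n+2)/2`, `h ∈ {1,…,n(n+1)/2}`, if `p / log p ≥ 9c(h+n+1)(log(h+n+1))² log q`, then
with probability at least `1 − n^{−γ log p}` over `p` i.i.d. uniform samples `Y` from `[−Δ,Δ]^n`,
for every coefficient vector `z̄ = (z̄_Q, z̄_L)` with `h`-sparse quadratic part and every `η ≥ 0`,
noise `ε'` with `‖ε'‖₂ ≤ η`, every minimizer `z*` of `‖z_Q‖₁` over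
`{z : ‖M(ψ,Y)z − b‖₂ ≤ η}` with `b = M(ψ,Y)z̄ + ε'` satisfies
`‖z* − z̄‖₂ ≤ (c_partial/√p)·η`. -/
theorem noisy_sparse_hessian_recovery_hypercube :
    ∃ c > (0 : ℝ), ∃ γ > (0 : ℝ), ∃ c_partial > (0 : ℝ),
      ∀ (n : ℕ), 2 ≤ n →
      ∀ (Δ : ℝ), 0 < Δ →
      ∀ (h : ℕ), 1 ≤ h → h ≤ n * (n + 1) / 2 →
      ∀ (p : ℕ),
      9 * c * ((h : ℝ) + n + 1) * Real.log ((h : ℝ) + n + 1) ^ 2 *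
          Real.log ((n + 1) * (n + 2) / 2 : ℕ) ≤ (p : ℝ) / Real.log p →
      ENNReal.ofReal (1 - (n : ℝ) ^ (-(γ * Real.log p))) ≤
        Measure.pi (fun _ : Fin p => mu n Δ)
          {Y : Fin p → (Fin n → ℝ) |
            ∀ zbar : Idx n → ℝ, Sparse h (fun j : QIdx n => zbar (Sum.inl j)) →
              ∀ η : ℝ, 0 ≤ η →
              ∀ ε' : Fin p → ℝ, l2 ε' ≤ η →
              ∀ zstar : Idx n → ℝ,
                (l2 ((Matrix.of fun (i : Fin p) (j : Idx n) => psi n Δ j (Y i)).mulVec zstar -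
                      ((Matrix.of fun (i : Fin p) (j : Idx n) => psi n Δ j (Y i)).mulVec zbar +
                        ε')) ≤ η ∧
                  ∀ z : Idx n → ℝ,
                    l2 ((Matrix.of fun (i : Fin p) (j : Idx n) => psi n Δ j (Y i)).mulVec z -
                        ((Matrix.of fun (i : Fin p) (j : Idx n) => psi n Δ j (Y i)).mulVec zbar +
                          ε')) ≤ η →
                      l1 (fun j : QIdx n => zstar (Sum.inl j)) ≤
                        l1 (fun j : QIdx n => z (Sum.inl j))) →
                l2 (zstar - zbar) ≤ c_partial / Real.sqrt p * η} := by
  refine ⟨10 ^ 11, by norm_num, 1, by norm_num, 8, by norm_num, ?_⟩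
  intro n hn Δ hΔ h h1 _ p H
  obtain ⟨hp, hnum⟩ := numeric n hn h p h1 H
  have hnu := nu_prob hΔ
  have hmu : IsProbabilityMeasure (mu n Δ) := by rw [mu_eq hΔ]; infer_instance
  set P := Measure.pi (fun _ : Fin p => mu n Δ) with hP
  have hPp : IsProbabilityMeasure P := by rw [hP]; infer_instance
  clear H
  obtain ⟨m, hm⟩ : ∃ m, m = 1000 * (h + n + 1) := ⟨_, rfl⟩
  rw [← hm] at hnum
  set δ : ℝ := (n : ℝ) ^ (-(1 * Real.log p)) with hδ
  have δ0 : 0 ≤ δ := by positivity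
  let bad : (Fin m → Idx n × Bool) → Set (Fin p → Fin n → ℝ) := fun k =>
    {Y | ¬ ((p : ℝ) / 2 * ∑ j, uvec k j ^ 2 ≤ ∑ i, (∑ j, psi' n Δ j (Y i) * uvec k j) ^ 2)}
  have hbad : P (⋃ k, bad k) ≤ ENNReal.ofReal δ := by
    refine (measure_iUnion_fintype_le _ _).trans ?_
    calc ∑ k, P (bad k) ≤ ∑ k : Fin m → Idx n × Bool, ENNReal.ofReal (Real.exp (-(p / 2880000))) := by
          refine Finset.sum_le_sum fun k _ => ?_
          rw [← ofReal_measureReal (h := measure_ne_top P _)]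
          exact ENNReal.ofReal_le_ofReal (tail_one hΔ _ p)
      _ = ENNReal.ofReal (((2 * Fintype.card (Idx n) : ℕ) : ℝ) ^ m * Real.exp (-(p / 2880000))) := by
          rw [Finset.sum_const, ENNReal.ofReal_mul (by positivity), ← Nat.cast_pow,
            ENNReal.ofReal_natCast, nsmul_eq_mul, Finset.card_univ, Fintype.card_fun,
            Fintype.card_prod, Fintype.card_bool, Fintype.card_fin, mul_comm 2]
      _ ≤ _ := ENNReal.ofReal_le_ofReal hnum
  rw [ENNReal.ofReal_sub _ δ0, ENNReal.ofReal_one, tsub_le_iff_right]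
  refine le_trans ?_ (add_le_add_right hbad _)
  have hcube := ae_cube (n := n) (p := p) hΔ
  rw [← hP] at hcube
  have huniv : (1 : ENNReal) = P Set.univ := by simp [hP]
  rw [huniv]
  refine le_trans (measure_mono_ae ?_) (measure_union_le _ _)
  filter_upwards [hcube] with Y hY _
  by_cases hb : Y ∈ ⋃ k, bad k
  · exact Or.inr hb
  left
  have good : ∀ k : Fin m → Idx n × Bool,
      (p : ℝ) / 2 * ∑ j, uvec k j ^ 2 ≤ ∑ i, (∑ j, psi' n Δ j (Y i) * uvec k j) ^ 2 := by
    intro k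
    by_contra hk
    exact hb (Set.mem_iUnion.2 ⟨k, hk⟩)
  have epsi : ∀ i j, psi' n Δ j (Y i) = psi n Δ j (Y i) := by
    intro i j
    unfold psi'
    congr 1
    funext k
    exact pr_eq (hY i k)
  intro zbar hsp η hη ε' hε zstar ⟨hfeas, hmin⟩
  set A := (Matrix.of fun (i : Fin p) (j : Idx n) => psi n Δ j (Y i)) with hA
  set x : Idx n → ℝ := zstar - zbar with hx
  have hl := hmin zbar (by
    have : A.mulVec zbar - (A.mulVec zbar + ε') = -ε' := by abel
    rw [this]
    have : l2 (-ε') = l2 ε' := by simp [l2]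
    rw [this]; exact hε)
  have hcone := cone (h := h) (fun j : QIdx n => zbar (Sum.inl j)) (fun j => x (Sum.inl j))
    (fun j : LIdx n => x (Sum.inr j)) hsp (by
      have : (fun j : QIdx n => zbar (Sum.inl j) + x (Sum.inl j)) =
        fun j => zstar (Sum.inl j) := by
        funext j; simp [hx]
      rw [this]; exact hl)
  have hlow := lower_bound (s := h + n + 1) (m := m) (fun i j => psi' n Δ j (Y i))
    (fun i j => psi'_abs hΔ j (Y i)) (by omega) hm good x (by
      rw [Fintype.sum_sum_type (fun j => |x j|), Fintype.sum_sum_type (fun j => x j ^ 2)]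
      have hcard : h + Fintype.card (LIdx n) = h + n + 1 := by
        simp only [LIdx, Fintype.card_sum, Fintype.card_fin, Fintype.card_unit]
        rfl
      rw [hcard] at hcone
      exact hcone)
  simp_rw [epsi] at hlow
  have hAx : ∑ i, (∑ j, psi n Δ j (Y i) * x j) ^ 2 ≤ 4 * η ^ 2 := by
    have e : ∀ i, ∑ j, psi n Δ j (Y i) * x j =
        (A.mulVec zstar - (A.mulVec zbar + ε')) i + ε' i := by
      intro i
      have : ∑ j, psi n Δ j (Y i) * x j = A.mulVec x i := rfl
      rw [this, hx, Matrix.mulVec_sub]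
      simp only [Pi.sub_apply, Pi.add_apply]
      ring
    have b1 := pow_le_pow_left₀ (l2_nonneg _) hfeas 2
    have b2 := pow_le_pow_left₀ (l2_nonneg _) hε 2
    rw [l2_sq] at b1 b2
    calc ∑ i, (∑ j, psi n Δ j (Y i) * x j) ^ 2
        ≤ ∑ i, (2 * (A.mulVec zstar - (A.mulVec zbar + ε')) i ^ 2 + 2 * ε' i ^ 2) := by
          refine Finset.sum_le_sum fun i _ => ?_
          rw [e i]
          nlinarith [sq_nonneg ((A.mulVec zstar - (A.mulVec zbar + ε')) i - ε' i)]
      _ = 2 * ∑ i, (A.mulVec zstar - (A.mulVec zbar + ε')) i ^ 2 + 2 * ∑ i, ε' i ^ 2 := by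
          rw [Finset.sum_add_distrib, Finset.mul_sum, Finset.mul_sum]
      _ ≤ _ := by linarith
  have hp0 : (0 : ℝ) < p := by
    have : 0 < p := by omega
    exact_mod_cast this
  refine le_of_sq_le_sq ?_ (by positivity)
  rw [l2_sq, mul_pow, div_pow, Real.sq_sqrt hp0.le, div_mul_eq_mul_div, le_div_iff₀ hp0]
  linarith
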